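/- Let n ∈ ℕ with n ≥ 1 and β ∈ (0,1]. Let χ ∈ C_c^∞(ℝ) with χ ≡ 1 on [−1,1] and χ'(x) > −1 for all x, and set ψ(x) := xⁿ|x|^β χ(x) ∈ C^{n,β}_0(ℝ,ℝ). Then for every γ > 0 and every α ∈ (0,β) with α > β − γ, the map θ : t ↦ ψ∘(Id + tχ) from a neighborhood of 0 in ℝ into C^{n,α}_b(ℝ,ℝ) is not Hölder continuous of order γ: for every interval I containing 0, the set { ‖θ(t) − θ(s)‖_{n,α} / |t−s|^γ : s, t ∈ I, s ≠ t } is unbounded. -/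

import Mathlib

open Function Set Filter Topology MeasureTheory
open scoped ENNReal NNReal

noncomputable section

section Defs

variable {E F : Type*} [NormedAddCommGroup E] [NormedSpace ℝ E]
  [NormedAddCommGroup F] [NormedSpace ℝ F]

/-- `‖f‖_n = max_{0 ≤ l ≤ n} sup_x ‖f⁽ˡ⁾(x)‖`, as an extended real. -/
def eCnb (n : ℕ) (f : E → F) : ℝ≥0∞ :=
  ⨆ (l : Fin (n + 1)) (x : E), (‖iteratedFDeriv ℝ (l : ℕ) f x‖₊ : ℝ≥0∞)

/-- The Hölder seminorm `[f]_{n,α}`, as an extended real. -/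
def eHsemi (n : ℕ) (α : ℝ) (f : E → F) : ℝ≥0∞ :=
  ⨆ (x : E) (y : E) (_ : x ≠ y),
    (‖iteratedFDeriv ℝ n f x - iteratedFDeriv ℝ n f y‖₊ : ℝ≥0∞) / edist x y ^ α

/-- The Hölder norm `‖f‖_{n,α} = max(‖f‖_n, [f]_{n,α})`, as an extended real. -/
def eHnorm (n : ℕ) (α : ℝ) (f : E → F) : ℝ≥0∞ := max (eCnb n f) (eHsemi n α f)

/-- The Hölder norm `‖f‖_{n,α}` as a real number (junk value `0` when infinite). -/
def hnorm (n : ℕ) (α : ℝ) (f : E → F) : ℝ := (eHnorm n α f).toReal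

/-- Membership in the global Hölder space `C^{n,α}_b(E,F)`. -/
def MemCb (n : ℕ) (α : ℝ) (f : E → F) : Prop :=
  ContDiff ℝ (n : ℕ∞) f ∧ eHnorm n α f < ⊤

/-- Membership in `C^{n,α}_0(E,F)`: moreover all derivatives up to order `n`
vanish at infinity. -/
def MemC0 (n : ℕ) (α : ℝ) (f : E → F) : Prop :=
  MemCb n α f ∧
    ∀ l ≤ n, Tendsto (fun x => ‖iteratedFDeriv ℝ l f x‖) (cocompact E) (𝓝 0)

end Defs

/-- `ℝ^d` -/
abbrev Euc (d : ℕ) : Type := EuclideanSpace ℝ (Fin d)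

/-- Membership in the diffeomorphism group `D^{n,β}(ℝ^d)`:
`Φ - Id ∈ C^{n,β}_0` and `det dΦ(x) > 0` everywhere. -/
def MemD (d n : ℕ) (β : ℝ) (Φ : Euc d → Euc d) : Prop :=
  MemC0 n β (fun x => Φ x - x) ∧
    ∀ x, 0 < LinearMap.det ((fderiv ℝ Φ x : Euc d →L[ℝ] Euc d) : Euc d →ₗ[ℝ] Euc d)

end

/-- `ψ(x) = xⁿ |x|^β χ(x)` -/
noncomputable def psiW (n : ℕ) (β : ℝ) (χ : ℝ → ℝ) : ℝ → ℝ :=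
  fun x => x ^ n * |x| ^ β * χ x

theorem hasDerivAt_pow_succ_mul_abs_rpow {β : ℝ} (hβ : 0 < β) (k : ℕ) (x : ℝ) :
    HasDerivAt (fun y : ℝ => y ^ (k + 1) * |y| ^ β) ((k + 1 + β) * (x ^ k * |x| ^ β)) x := by
  rcases eq_or_ne x 0 with rfl | hx
  · rw [hasDerivAt_iff_tendsto_slope]
    have hc : Continuous fun y : ℝ => y ^ k * |y| ^ β :=
      (continuous_pow k).mul (continuous_abs.rpow_const fun _ => Or.inr hβ.le)
    have h0 := (hc.tendsto 0).mono_left (nhdsWithin_le_nhds (s := {0}ᶜ))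
    have hz : (0 : ℝ) ^ k * |(0 : ℝ)| ^ β = 0 := by simp [Real.zero_rpow hβ.ne']
    rw [hz] at h0 ⊢
    rw [mul_zero]
    refine h0.congr' ?_
    filter_upwards [self_mem_nhdsWithin] with y hy
    have hy0 : y ≠ 0 := hy
    simp only [slope_def_field, Real.zero_rpow hβ.ne', abs_zero, mul_zero, sub_zero]
    field_simp
    ring
  · have h := (hasDerivAt_pow (k + 1) x).mul
      ((hasDerivAt_abs hx).rpow_const (p := β) (Or.inl (abs_ne_zero.2 hx)))
    refine h.congr_deriv ?_
    have habs : |x| ^ β = |x| ^ (β - 1) * |x| := by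
      rw [← Real.rpow_add_one (abs_ne_zero.2 hx)]; ring_nf
    have hs : x * (SignType.sign x : ℝ) = |x| := self_mul_sign x
    simp only [Nat.add_sub_cancel, Nat.cast_add, Nat.cast_one]
    rw [pow_succ]
    linear_combination β * x ^ k * |x| ^ (β - 1) * hs - β * x ^ k * habs

theorem contDiff_pow_mul_abs_rpow {β : ℝ} (hβ : 0 < β) (n : ℕ) :
    ContDiff ℝ n (fun y : ℝ => y ^ n * |y| ^ β) := by
  induction n with
  | zero =>
    refine contDiff_zero.2 ?_
    exact (continuous_pow 0).mul (continuous_abs.rpow_const fun _ => Or.inr hβ.le)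
  | succ k ih =>
    push_cast
    refine contDiff_succ_iff_deriv.2
      ⟨fun x => (hasDerivAt_pow_succ_mul_abs_rpow hβ k x).differentiableAt, by simp, ?_⟩
    rw [funext fun x => (hasDerivAt_pow_succ_mul_abs_rpow hβ k x).deriv]
    exact contDiff_const.mul ih

theorem exists_iteratedDeriv_pow_mul_abs_rpow {β : ℝ} (hβ : 0 < β) (n : ℕ) :
    ∃ c : ℝ, 0 < c ∧ ∀ x,
      iteratedDeriv n (fun y : ℝ => y ^ n * |y| ^ β) x = c * |x| ^ β := by
  induction n with
  | zero => exact ⟨1, one_pos, fun x => by simp⟩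
  | succ k ih =>
    obtain ⟨c, hc, h⟩ := ih
    refine ⟨(k + 1 + β) * c, by positivity, fun x => ?_⟩
    rw [iteratedDeriv_succ', funext fun x => (hasDerivAt_pow_succ_mul_abs_rpow hβ k x).deriv,
      iteratedDeriv_const_mul_field, h, mul_assoc]

theorem abs_abs_rpow_sub_abs_rpow_le {β : ℝ} (h0 : 0 ≤ β) (h1 : β ≤ 1) (x y : ℝ) :
    |(|x| ^ β - |y| ^ β)| ≤ |x - y| ^ β := by
  have key : ∀ x y : ℝ, |x| ^ β ≤ |x - y| ^ β + |y| ^ β := fun x y => by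
    have h : |x| ≤ |x - y| + |y| := by simpa using abs_add_le (x - y) y
    refine (Real.rpow_le_rpow (abs_nonneg x) h h0).trans ?_
    exact_mod_cast NNReal.rpow_add_le_add_rpow (Real.nnabs (x - y)) (Real.nnabs y) h0 h1
  rw [abs_le]
  have h₁ := key x y
  have h₂ := key y x
  rw [abs_sub_comm y x] at h₂
  constructor <;> linarith

theorem contDiffAt_pow_mul_abs_rpow_of_ne_zero (n : ℕ) (β : ℝ) {x : ℝ} (hx : x ≠ 0)
    (m : ℕ∞) : ContDiffAt ℝ m (fun y : ℝ => y ^ n * |y| ^ β) x :=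
  (contDiffAt_id.pow n).mul ((contDiffAt_abs hx).rpow_const_of_ne (abs_ne_zero.2 hx))

theorem nnnorm_iteratedFDeriv_sub_eq (n : ℕ) (f : ℝ → ℝ) (x y : ℝ) :
    (‖iteratedFDeriv ℝ n f x - iteratedFDeriv ℝ n f y‖₊ : ℝ≥0∞) =
      ENNReal.ofReal |iteratedDeriv n f x - iteratedDeriv n f y| := by
  rw [iteratedFDeriv_eq_equiv_comp, Function.comp_apply, Function.comp_apply, ← map_sub,
    ← enorm_eq_nnnorm, LinearIsometryEquiv.enorm_map, Real.enorm_eq_ofReal_abs]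

theorem nnnorm_div_edist_rpow_eq (n : ℕ) (α : ℝ) (f : ℝ → ℝ) {x y : ℝ} (hxy : x ≠ y) :
    (‖iteratedFDeriv ℝ n f x - iteratedFDeriv ℝ n f y‖₊ : ℝ≥0∞) / edist x y ^ α =
      ENNReal.ofReal (|iteratedDeriv n f x - iteratedDeriv n f y| / |x - y| ^ α) := by
  have h : 0 < |x - y| := abs_pos.2 (sub_ne_zero.2 hxy)
  rw [nnnorm_iteratedFDeriv_sub_eq, edist_dist, Real.dist_eq, ENNReal.ofReal_rpow_of_pos h,
    ENNReal.ofReal_div_of_pos (Real.rpow_pos_of_pos h α)]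

theorem eHnorm_lt_top_of_local {n : ℕ} {α : ℝ} (hα : 0 ≤ α) {f : ℝ → ℝ} (hf : ContDiff ℝ n f)
    (hc : HasCompactSupport f)
    (hloc : ∀ R : ℝ, ∃ K : ℝ, ∀ x ∈ Icc (-R) R, ∀ y ∈ Icc (-R) R, |x - y| ≤ 1 →
      |iteratedDeriv n f x - iteratedDeriv n f y| ≤ K * |x - y| ^ α) :
    eHnorm n α f < ⊤ := by
  have hcont : ∀ l ≤ n, Continuous (iteratedFDeriv ℝ l f) := fun l hl =>
    hf.continuous_iteratedFDeriv (by exact_mod_cast hl)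
  have hbd : ∀ l ≤ n, ∃ M, ∀ x, ‖iteratedFDeriv ℝ l f x‖ ≤ M := fun l hl =>
    (hcont l hl).bounded_above_of_compact_support (hc.iteratedFDeriv l)
  refine max_lt ?_ ?_
  · choose! M hM using hbd
    refine lt_of_le_of_lt (b := ⨆ l : Fin (n + 1), ENNReal.ofReal (M l)) ?_ ?_
    · refine iSup_mono fun l => iSup_le fun x => ?_
      rw [← enorm_eq_nnnorm, ← ofReal_norm]
      exact ENNReal.ofReal_le_ofReal (hM l (Nat.lt_succ_iff.1 l.2) x)
    · obtain ⟨l, hl⟩ := exists_eq_ciSup_of_finite (f := fun l : Fin (n + 1) => ENNReal.ofReal (M l))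
      exact hl ▸ ENNReal.ofReal_lt_top
  · obtain ⟨M, hM⟩ := hbd n le_rfl
    simp only [norm_iteratedFDeriv_eq_norm_iteratedDeriv, Real.norm_eq_abs] at hM
    obtain ⟨R, hR⟩ := hc.isCompact.isBounded.subset_closedBall (0 : ℝ)
    have hzero : ∀ x, R < |x| → iteratedDeriv n f x = 0 := fun x hx => by
      have h : x ∉ tsupport f := fun h => by
        have := hR h
        rw [mem_closedBall_zero_iff, Real.norm_eq_abs] at this
        exact this.not_gt hx
      have h' : iteratedFDeriv ℝ n f x = 0 := by
        by_contra hne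
        exact h (support_iteratedFDeriv_subset n hne)
      rw [iteratedDeriv_eq_iteratedFDeriv, h']
      simp
    obtain ⟨K, hK⟩ := hloc (R + 1)
    have hM0 : 0 ≤ M := (abs_nonneg _).trans (hM 0)
    refine lt_of_le_of_lt (b := ENNReal.ofReal (max K (2 * M))) ?_ ENNReal.ofReal_lt_top
    refine iSup_le fun x => iSup_le fun y => iSup_le fun hxy => ?_
    rw [nnnorm_div_edist_rpow_eq n α f hxy]
    refine ENNReal.ofReal_le_ofReal ?_
    have hd : 0 < |x - y| := abs_pos.2 (sub_ne_zero.2 hxy)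
    have hdα : 0 < |x - y| ^ α := Real.rpow_pos_of_pos hd α
    rw [div_le_iff₀ hdα]
    rcases le_total |x - y| 1 with h1 | h1
    · by_cases hout : R < |x| ∧ R < |y|
      · rw [hzero x hout.1, hzero y hout.2, sub_zero, abs_zero]
        have : 0 ≤ max K (2 * M) := le_max_of_le_right (by linarith)
        positivity
      · have hxR : |x| ≤ R + 1 ∧ |y| ≤ R + 1 := by
          have h₁ := abs_sub_abs_le_abs_sub x y
          have h₂ := abs_sub_abs_le_abs_sub y x
          rw [abs_sub_comm y x] at h₂
          by_cases hx : R < |x|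
          · have hy : |y| ≤ R := not_lt.1 fun hy => hout ⟨hx, hy⟩
            constructor <;> linarith
          · constructor <;> linarith
        refine (hK x (abs_le.1 hxR.1) y (abs_le.1 hxR.2) h1).trans ?_
        gcongr
        exact le_max_left _ _
    · have hone : 1 ≤ |x - y| ^ α := Real.one_le_rpow h1 hα
      calc |iteratedDeriv n f x - iteratedDeriv n f y|
          ≤ |iteratedDeriv n f x| + |iteratedDeriv n f y| := abs_sub _ _
        _ ≤ max K (2 * M) * 1 := by
          linarith [hM x, hM y, le_max_right K (2 * M)]
        _ ≤ max K (2 * M) * |x - y| ^ α := by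
          have : 0 ≤ max K (2 * M) := le_max_of_le_right (by linarith)
          gcongr

theorem div_rpow_le_hnorm {n : ℕ} {α : ℝ} {f : ℝ → ℝ} (hfin : eHnorm n α f < ⊤) {x y : ℝ}
    (hxy : x ≠ y) :
    |iteratedDeriv n f x - iteratedDeriv n f y| / |x - y| ^ α ≤ hnorm n α f := by
  refine (ENNReal.ofReal_le_iff_le_toReal hfin.ne).1 ?_
  rw [← nnnorm_div_edist_rpow_eq n α f hxy]
  refine le_trans ?_ (le_max_right _ _)
  exact le_iSup_of_le x (le_iSup_of_le y (le_iSup_of_le hxy le_rfl))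

/-- The part of `ψ ∘ (Id + tχ) - ψ` left after removing its singular part near the origin. -/
noncomputable def shiftRemainder (n : ℕ) (β t : ℝ) (χ : ℝ → ℝ) : ℝ → ℝ := fun x =>
  psiW n β χ (x + t * χ x) - psiW n β χ x - ((x + t) ^ n * |x + t| ^ β - x ^ n * |x| ^ β)

theorem shiftRemainder_eventuallyEq_zero {χ : ℝ → ℝ} (hχ1 : ∀ x ∈ Icc (-1 : ℝ) 1, χ x = 1)
    (n : ℕ) (β : ℝ) {t : ℝ} (ht : |t| < 1 / 2) {x : ℝ} (hx : |x| < 1 / 2) :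
    shiftRemainder n β t χ =ᶠ[𝓝 x] 0 := by
  filter_upwards [(isOpen_lt continuous_abs continuous_const).mem_nhds hx] with y hy
  have hy : |y| < 1 / 2 := hy
  rw [abs_lt] at hy ht
  have h₁ : χ y = 1 := hχ1 y ⟨by linarith, by linarith⟩
  have h₂ : χ (y + t) = 1 := hχ1 (y + t) ⟨by linarith, by linarith⟩
  simp [shiftRemainder, psiW, h₁, h₂]

theorem contDiff_shiftRemainder {χ : ℝ → ℝ} (hχ : ContDiff ℝ (⊤ : ℕ∞) χ)
    (hχ1 : ∀ x ∈ Icc (-1 : ℝ) 1, χ x = 1) (n : ℕ) (β : ℝ) {t : ℝ} (ht : |t| < 1 / 2)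
    (htχ : ∀ x, |t * χ x| < 1 / 2) : ContDiff ℝ (⊤ : ℕ∞) (shiftRemainder n β t χ) := by
  have hψ : ∀ x ≠ 0, ContDiffAt ℝ (⊤ : ℕ∞) (psiW n β χ) x := fun x hx =>
    (contDiffAt_pow_mul_abs_rpow_of_ne_zero n β hx _).mul hχ.contDiffAt
  have hne : ∀ x u : ℝ, 1 / 2 ≤ |x| → |u| < 1 / 2 → x + u ≠ 0 := fun x u hx hu h => by
    rw [eq_neg_of_add_eq_zero_left h, abs_neg] at hx
    linarith
  rw [contDiff_iff_contDiffAt]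
  intro x
  rcases lt_or_ge |x| (1 / 2) with hx | hx
  · exact contDiffAt_const.congr_of_eventuallyEq
      (shiftRemainder_eventuallyEq_zero hχ1 n β ht hx)
  · have hx0 : x ≠ 0 := by simpa using hne x 0 hx (by norm_num)
    refine ContDiffAt.sub (ContDiffAt.sub ?_ (hψ x hx0)) (ContDiffAt.sub ?_
      (contDiffAt_pow_mul_abs_rpow_of_ne_zero n β hx0 _))
    · exact ContDiffAt.comp (g := psiW n β χ) (f := fun y => y + t * χ y) x (hψ _ (hne x (t * χ x) hx (htχ x)))
        (contDiffAt_id.add (contDiffAt_const.mul hχ.contDiffAt))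
    · exact ContDiffAt.comp (g := fun y : ℝ => y ^ n * |y| ^ β) (f := fun y => y + t) x
        (contDiffAt_pow_mul_abs_rpow_of_ne_zero n β (hne x t hx ht) _)
        (contDiffAt_id.add contDiffAt_const)

theorem exists_iteratedDeriv_psiW_shift_sub (n : ℕ) {β : ℝ} (hβ : 0 < β) {χ : ℝ → ℝ}
    (hχ : ContDiff ℝ (⊤ : ℕ∞) χ) (hχ1 : ∀ x ∈ Icc (-1 : ℝ) 1, χ x = 1) :
    ∃ c : ℝ, 0 < c ∧ ∀ t : ℝ, |t| < 1 / 2 → (∀ x, |t * χ x| < 1 / 2) →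
      ContDiff ℝ n (fun x => psiW n β χ (x + t * χ x) - psiW n β χ x) ∧
      ∀ x, iteratedDeriv n (fun x => psiW n β χ (x + t * χ x) - psiW n β χ x) x =
        iteratedDeriv n (shiftRemainder n β t χ) x + (c * |x + t| ^ β - c * |x| ^ β) := by
  obtain ⟨c, hc, hder⟩ := exists_iteratedDeriv_pow_mul_abs_rpow hβ n
  refine ⟨c, hc, fun t ht htχ => ?_⟩
  set P : ℝ → ℝ := fun y => y ^ n * |y| ^ β with hP
  have hPn : ContDiff ℝ n P := contDiff_pow_mul_abs_rpow hβ n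
  have hPt : ContDiff ℝ n (fun x => P (x + t)) := hPn.comp (contDiff_id.add contDiff_const)
  have hF : ContDiff ℝ n (shiftRemainder n β t χ) :=
    (contDiff_shiftRemainder hχ hχ1 n β ht htχ).of_le (by exact_mod_cast le_top)
  have hsplit : (fun x => psiW n β χ (x + t * χ x) - psiW n β χ x) =
      shiftRemainder n β t χ + ((fun x => P (x + t)) - P) := by
    funext x
    simp [shiftRemainder, hP]
  rw [hsplit]
  have hPP : ContDiff ℝ n ((fun x => P (x + t)) - P) := hPt.sub hPn
  refine ⟨hF.add hPP, fun x => ?_⟩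
  rw [iteratedDeriv_add hF.contDiffAt hPP.contDiffAt,
    iteratedDeriv_sub hPt.contDiffAt hPn.contDiffAt, iteratedDeriv_comp_add_const]
  simp only [hder]

theorem eHnorm_psiW_shift_sub_lt_top (n : ℕ) {α β : ℝ} (hα : 0 < α) (hαβ : α ≤ β) (hβ1 : β ≤ 1)
    {χ : ℝ → ℝ} (hχ : ContDiff ℝ (⊤ : ℕ∞) χ) (hχc : HasCompactSupport χ)
    (hχ1 : ∀ x ∈ Icc (-1 : ℝ) 1, χ x = 1) {t : ℝ} (ht : |t| < 1 / 2)
    (htχ : ∀ x, |t * χ x| < 1 / 2) :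
    eHnorm n α (fun x => psiW n β χ (x + t * χ x) - psiW n β χ x) < ⊤ := by
  have hβ : 0 < β := hα.trans_le hαβ
  obtain ⟨c, hc, H⟩ := exists_iteratedDeriv_psiW_shift_sub n hβ hχ hχ1
  obtain ⟨hsm, hder⟩ := H t ht htχ
  refine eHnorm_lt_top_of_local hα.le hsm ?_ fun R => ?_
  · refine hχc.mono fun x hx => ?_
    by_contra h
    exact hx (by simp [notMem_support.1 h])
  · have hG : ContDiff ℝ 1 (iteratedDeriv n (shiftRemainder n β t χ)) :=
      (contDiff_nat_succ_iff_contDiff_one_iteratedDeriv.1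
        ((contDiff_shiftRemainder hχ hχ1 n β ht htχ).of_le (by exact_mod_cast le_top))).2
    obtain ⟨L, hL⟩ := hG.contDiffOn.exists_lipschitzOnWith one_ne_zero (convex_Icc (-R) R)
      isCompact_Icc
    refine ⟨L + 2 * c, fun x hx y hy hxy => ?_⟩
    have hpow : ∀ p, α ≤ p → |x - y| ^ p ≤ |x - y| ^ α := fun p hp =>
      Real.rpow_le_rpow_of_exponent_ge_of_imp (abs_nonneg _) hxy hp fun _ h =>
        absurd h (hα.trans_le hp).ne'
    have h₁ := hL.dist_le_mul x hx y hy
    rw [Real.dist_eq, Real.dist_eq] at h₁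
    have h₂ := abs_abs_rpow_sub_abs_rpow_le hβ.le hβ1 (x + t) (y + t)
    have h₃ := abs_abs_rpow_sub_abs_rpow_le hβ.le hβ1 x y
    rw [add_sub_add_right_eq_sub] at h₂
    have h₄ := hpow 1 (hαβ.trans hβ1)
    rw [Real.rpow_one] at h₄
    have h₅ := hpow β hαβ
    rw [hder, hder]
    calc _ = |(iteratedDeriv n (shiftRemainder n β t χ) x -
            iteratedDeriv n (shiftRemainder n β t χ) y) +
            c * (|x + t| ^ β - |y + t| ^ β) - c * (|x| ^ β - |y| ^ β)| := by ring_nf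
      _ ≤ |iteratedDeriv n (shiftRemainder n β t χ) x -
            iteratedDeriv n (shiftRemainder n β t χ) y| +
            c * |(|x + t| ^ β - |y + t| ^ β)| + c * |(|x| ^ β - |y| ^ β)| := by
          refine (abs_sub _ _).trans (add_le_add ((abs_add_le _ _).trans ?_) ?_) <;>
            simp [abs_mul, abs_of_pos hc]
      _ ≤ L * |x - y| ^ α + c * |x - y| ^ α + c * |x - y| ^ α := by
          gcongr
          · exact h₁.trans (by gcongr)
          · exact h₂.trans h₅
          · exact h₃.trans h₅
      _ = (L + 2 * c) * |x - y| ^ α := by ring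

theorem two_mul_rpow_le_hnorm_psiW_shift_sub (n : ℕ) {α β : ℝ} (hα : 0 < α) (hαβ : α ≤ β)
    (hβ1 : β ≤ 1) {χ : ℝ → ℝ} (hχ : ContDiff ℝ (⊤ : ℕ∞) χ) (hχc : HasCompactSupport χ)
    (hχ1 : ∀ x ∈ Icc (-1 : ℝ) 1, χ x = 1) :
    ∃ c : ℝ, 0 < c ∧ ∀ t : ℝ, 0 < t → t < 1 / 2 → (∀ x, |t * χ x| < 1 / 2) →
      2 * c * t ^ (β - α) ≤ hnorm n α (fun x => psiW n β χ (x + t * χ x) - psiW n β χ x) := by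
  have hβ : 0 < β := hα.trans_le hαβ
  obtain ⟨c, hc, H⟩ := exists_iteratedDeriv_psiW_shift_sub n hβ hχ hχ1
  refine ⟨c, hc, fun t ht0 ht htχ => ?_⟩
  have ht' : |t| < 1 / 2 := by rwa [abs_of_pos ht0]
  have hzero : ∀ x, |x| < 1 / 2 → iteratedDeriv n (shiftRemainder n β t χ) x = 0 := fun x hx => by
    rw [(shiftRemainder_eventuallyEq_zero hχ1 n β ht' hx).iteratedDeriv_eq n]
    exact iteratedDeriv_const_zero
  have hle := div_rpow_le_hnorm (eHnorm_psiW_shift_sub_lt_top n hα hαβ hβ1 hχ hχc hχ1 ht' htχ)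
    (x := 0) (y := -t) (by linarith)
  refine le_trans (le_of_eq ?_) hle
  rw [(H t ht' htχ).2, (H t ht' htχ).2, hzero 0 (by norm_num), hzero (-t) (by rwa [abs_neg])]
  have ht2 : c * t ^ β + c * t ^ β = 2 * c * t ^ β := by ring
  have hpos : 0 < 2 * c * t ^ β := by positivity
  simp only [zero_add, neg_add_cancel, abs_zero, Real.zero_rpow hβ.ne', mul_zero, sub_zero,
    abs_neg, abs_of_pos ht0, zero_sub, sub_neg_eq_add, ht2, abs_of_pos hpos]
  rw [Real.rpow_sub ht0]
  ring

/-- optimality of the `C^{0,ω}` regularity: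
with `χ ∈ C_c^∞(ℝ)`, `χ ≡ 1` on `[−1,1]`, `χ' > −1`, and
`ψ(x) = xⁿ|x|^β χ(x) ∈ C^{n,β}_0(ℝ,ℝ)`, for every `γ > 0` and every
`α ∈ (β−γ, β) ∩ (0,β)` the curve `θ : t ↦ ψ∘(Id+tχ)` into `C^{n,α}_b(ℝ,ℝ)` is
not Hölder continuous of order `γ` near `0`: on every interval `I ∋ 0` the
quotients `‖θ(t)−θ(s)‖_{n,α}/|t−s|^γ` are unbounded. -/
theorem stmt13 (n : ℕ) (hn : 1 ≤ n) (β : ℝ) (hβ0 : 0 < β) (hβ1 : β ≤ 1)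
    (χ : ℝ → ℝ) (hχsm : ContDiff ℝ (⊤ : ℕ∞) χ) (hχc : HasCompactSupport χ)
    (hχ1 : ∀ x ∈ Icc (-1 : ℝ) 1, χ x = 1) (hχ' : ∀ x, -1 < deriv χ x)
    (γ : ℝ) (hγ : 0 < γ) (α : ℝ) (hα0 : 0 < α) (hαβ : α < β) (hαγ : β - γ < α) :
    ∀ a b : ℝ, a < 0 → 0 < b → ∀ C : ℝ,
      ∃ s ∈ Icc a b, ∃ t ∈ Icc a b, s ≠ t ∧
        C * |t - s| ^ γ <
          hnorm n α (fun x => psiW n β χ (x + t * χ x) - psiW n β χ (x + s * χ x)) := by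
  intro a b ha hb C
  obtain ⟨c, hc, H⟩ :=
    two_mul_rpow_le_hnorm_psiW_shift_sub n hα0 hαβ.le hβ1 hχsm hχc hχ1
  obtain ⟨M, hM⟩ := hχsm.continuous.bounded_above_of_compact_support hχc
  have hδ : 0 < γ - (β - α) := by linarith
  have hlim : Tendsto (fun t : ℝ => C * t ^ (γ - (β - α))) (𝓝[>] 0) (𝓝 0) := by
    have h : ContinuousAt (fun t : ℝ => C * t ^ (γ - (β - α))) 0 :=
      continuousAt_const.mul (Real.continuousAt_rpow_const 0 _ (Or.inr hδ.le))
    have h' : Tendsto (fun t : ℝ => C * t ^ (γ - (β - α))) (𝓝 0) (𝓝 0) := by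
      simpa [ContinuousAt, Real.zero_rpow hδ.ne'] using h
    exact h'.mono_left nhdsWithin_le_nhds
  have hlimM : Tendsto (fun t : ℝ => t * M) (𝓝[>] 0) (𝓝 0) := by
    have h : Tendsto (fun t : ℝ => t * M) (𝓝 0) (𝓝 (0 * M)) :=
      (continuous_id.mul continuous_const).tendsto 0
    rw [zero_mul] at h
    exact h.mono_left nhdsWithin_le_nhds
  have hev : ∀ᶠ t : ℝ in 𝓝[>] 0, (0 < t ∧ t < b ∧ t < 1 / 2 ∧ t * M < 1 / 2 ∧
      C * t ^ (γ - (β - α)) < 2 * c) := by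
    filter_upwards [self_mem_nhdsWithin, Ioo_mem_nhdsGT hb,
      Ioo_mem_nhdsGT (show (0 : ℝ) < 1 / 2 by norm_num),
      hlimM.eventually_lt_const (show (0 : ℝ) < 1 / 2 by norm_num),
      hlim.eventually_lt_const (show 0 < 2 * c by positivity)] with t h₁ h₂ h₃ h₄ h₅
    exact ⟨h₁, h₂.2, h₃.2, h₄, h₅⟩
  obtain ⟨t, ht0, htb, ht2, htM, htC⟩ := hev.exists
  refine ⟨0, ⟨ha.le, hb.le⟩, t, ⟨by linarith, htb.le⟩, ht0.ne, ?_⟩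
  have htχ : ∀ x, |t * χ x| < 1 / 2 := fun x => by
    rw [abs_mul, abs_of_pos ht0]
    exact (mul_le_mul_of_nonneg_left (hM x) ht0.le).trans_lt htM
  have hle := H t ht0 ht2 htχ
  simp only [zero_mul, add_zero]
  refine lt_of_lt_of_le ?_ hle
  rw [sub_zero, abs_of_pos ht0]
  calc C * t ^ γ = C * t ^ (γ - (β - α)) * t ^ (β - α) := by
        rw [mul_assoc, ← Real.rpow_add ht0, sub_add_cancel]
    _ < 2 * c * t ^ (β - α) := by
        have := Real.rpow_pos_of_pos ht0 (β - α)
        gcongr
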